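/- Suppose N ≥ 2 is an integer, δ, μ > 0 satisfy condition (H₁), and 2 ≤ p < N and 2 ≤ q < N. If 1/(δ+1) + 1/(μ+1) > (N(M−1) − M)/(N(M−1)), where M = max{p,q}, then for every R > 0 the system (S_R) possesses a regular radial solution (u,v). -/

import Mathlib

/-- A regular radial solution of system (S_R) on the ball of radius `R`. -/
def IsRadialSolution (N : ℕ) (p q δ μ R : ℝ) (u v : ℝ → ℝ) : Prop :=
  ContDiffOn ℝ 1 u (Set.Icc 0 R) ∧ ContDiffOn ℝ 1 v (Set.Icc 0 R) ∧
  ContDiffOn ℝ 2 u (Set.Ioc 0 R) ∧ ContDiffOn ℝ 2 v (Set.Ioc 0 R) ∧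
  (∀ r ∈ Set.Ico (0:ℝ) R, 0 < u r) ∧ (∀ r ∈ Set.Ico (0:ℝ) R, 0 < v r) ∧
  deriv u 0 = 0 ∧ deriv v 0 = 0 ∧ u R = 0 ∧ v R = 0 ∧
  (∀ r ∈ Set.Ioc (0:ℝ) R,
    deriv (fun s => s ^ ((N:ℝ) - 1) * |deriv u s| ^ (p - 2) * deriv u s) r
      = -(r ^ ((N:ℝ) - 1) * v r ^ δ)) ∧
  (∀ r ∈ Set.Ioc (0:ℝ) R,
    deriv (fun s => s ^ ((N:ℝ) - 1) * |deriv v s| ^ (q - 2) * deriv v s) r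
      = -(r ^ ((N:ℝ) - 1) * u r ^ μ))

open Set Filter Topology

lemma hasDerivAt_energyTerm {v A B : ℝ → ℝ} {N n δ r b' : ℝ} (hr : 0 < r) (hv0 : 0 < v r)
    (hB0 : 0 < B r) (hv : HasDerivAt v (-(B r) ^ n) r)
    (hA : HasDerivAt A (v r ^ δ - (N - 1) * A r / r) r) (hB : HasDerivAt B b' r) :
    HasDerivAt (fun x => v x * B x ^ (1 - n) * (N * A x - x * v x ^ δ))
      (B r * ((1 + δ) * (r * v r ^ δ) - N * A r) + v r * B r ^ (1 - n) * (N * A r - r * v r ^ δ) *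
        ((1 - n) * b' / B r - (N - 1) / r)) r := by
  have h := (hv.mul (hB.rpow_const (p := 1 - n) (Or.inl hB0.ne'))).mul
    ((hA.const_mul N).sub ((hasDerivAt_id r).mul (hv.rpow_const (p := δ) (Or.inl hv0.ne'))))
  refine h.congr_deriv ?_
  have e1 : B r ^ n * B r ^ (1 - n) = B r := by
    rw [← Real.rpow_add hB0]; simp
  have e2 : B r ^ (1 - n - 1) = B r ^ (1 - n) / B r := Real.rpow_sub_one hB0.ne' _
  have e3 : v r ^ (δ - 1) = v r ^ δ / v r := Real.rpow_sub_one hv0.ne' _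
  simp only [id, Pi.mul_apply, Pi.sub_apply, e2, e3]
  set b := B r ^ n
  set c := B r ^ (1 - n)
  set x := v r ^ δ
  rw [← e1]
  have hb : b ≠ 0 := by positivity
  have hc : c ≠ 0 := by positivity
  field_simp
  ring

section
variable {u v A B : ℝ → ℝ} {N m n δ μ : ℝ}

/-- The Pohozaev-type energy, increasing along radial solutions. -/
noncomputable def radialEnergy (N m n δ μ : ℝ) (u v A B : ℝ → ℝ) (r : ℝ) : ℝ :=
  r ^ (N - 2 + min m n) * (r * (A r * B r)
    - 1 / (1 + δ) * (v r * B r ^ (1 - n) * (N * A r - r * v r ^ δ))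
    - 1 / (1 + μ) * (u r * A r ^ (1 - m) * (N * B r - r * u r ^ μ)))

lemma hasDerivAt_radialEnergy_pos {r : ℝ} (hr : 0 < r) (hδ : 0 < δ) (hμ : 0 < μ) 
    (hm1 : m ≤ 1) (hn1 : n ≤ 1)
    (hu0 : 0 < u r) (hv0 : 0 < v r) (hA0 : 0 < A r) (hB0 : 0 < B r)
    (hu : HasDerivAt u (-(A r) ^ m) r) (hv : HasDerivAt v (-(B r) ^ n) r)
    (hA : HasDerivAt A (v r ^ δ - (N - 1) * A r / r) r)
    (hB : HasDerivAt B (u r ^ μ - (N - 1) * B r / r) r)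
    (hX : r * v r ^ δ ≤ N * A r) (hY : r * u r ^ μ ≤ N * B r)
    (hsub : 0 < N * (1 / (1 + δ) + 1 / (1 + μ)) - (N - 1 - min m n)) :
    ∃ e, 0 < e ∧ HasDerivAt (radialEnergy N m n δ μ u v A B) e r := by
  have h1 := (Real.hasDerivAt_rpow_const (x := r) (p := N - 2 + min m n) (Or.inl hr.ne')).mul
    ((((hasDerivAt_id r).mul (hA.mul hB)).sub
      ((hasDerivAt_energyTerm hr hv0 hB0 hv hA hB).const_mul (1 / (1 + δ)))).sub
      ((hasDerivAt_energyTerm hr hu0 hA0 hu hB hA).const_mul (1 / (1 + μ))))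
  refine ⟨_, ?_, h1⟩
  simp only [id, Pi.mul_apply, Pi.sub_apply]
  rw [Real.rpow_sub_one hr.ne']
  set P := r ^ (N - 2 + min m n) with hP
  set X := N * A r - r * v r ^ δ with hXd
  set Y := N * B r - r * u r ^ μ with hYd
  set θ := min m n
  have hP0 : 0 < P := by positivity
  have hX0 : 0 ≤ X := by linarith
  have hY0 : 0 ≤ Y := by linarith
  have hV : v r ^ δ = (N * A r - X) / r := by rw [hXd]; field_simp; ring
  have hU : u r ^ μ = (N * B r - Y) / r := by rw [hYd]; field_simp; ring
  rw [hV, hU]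
  have hθm : θ ≤ m := min_le_left _ _
  have hθn : θ ≤ n := min_le_right _ _
  set S := B r ^ (1 - n)
  set T := A r ^ (1 - m)
  have hS : 0 < S := by positivity
  have hT : 0 < T := by positivity
  set a := 1 / (1 + δ) with ha
  set b := 1 / (1 + μ) with hb
  have ha0 : 0 < a := by positivity
  have hb0 : 0 < b := by positivity
  have had : a * (1 + δ) = 1 := by rw [ha]; field_simp
  have hbd : b * (1 + μ) = 1 := by rw [hb]; field_simp
  have key : (0:ℝ) < P * (A r * B r * (N * (a + b) - (N - 1 - θ))
      + a * v r * S * X / r * ((n - θ) + (1 - n) * (Y / B r))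
      + b * u r * T * Y / r * ((m - θ) + (1 - m) * (X / A r))) := by
    apply mul_pos hP0
    have : 0 ≤ (n - θ) + (1 - n) * (Y / B r) :=
      add_nonneg (by linarith) (mul_nonneg (by linarith) (by positivity))
    have : 0 ≤ (m - θ) + (1 - m) * (X / A r) :=
      add_nonneg (by linarith) (mul_nonneg (by linarith) (by positivity))
    positivity
  refine key.trans_eq ?_
  have hδ' : δ = 1 / a - 1 := by field_simp; linarith
  have hμ' : μ = 1 / b - 1 := by field_simp; linarith
  rw [hδ', hμ']
  field_simp
  ring
end

lemma mul_rpow_le_of_radial {u A : ℝ → ℝ} {g : ℝ → ℝ} {N m r : ℝ} (hN : 1 ≤ N) (hm : 0 < m)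
    (hr : 0 < r) (hu0 : ∀ x, 0 < x → 0 < u x) (hA0 : ∀ x, 0 < x → 0 < A x)
    (hg : ∀ x, 0 < x → 0 ≤ g x) (hu : ∀ x, 0 < x → HasDerivAt u (-(A x) ^ m) x)
    (hA : ∀ x, 0 < x → HasDerivAt A (g x - (N - 1) * A x / x) x) :
    r * (2 ^ (-(N - 1)) * A r) ^ m ≤ u r := by
  have hflux : MonotoneOn (fun x => x ^ (N - 1) * A x) (Ioi 0) := by
    have hd : ∀ x, 0 < x → HasDerivAt (fun x => x ^ (N - 1) * A x) (x ^ (N - 1) * g x) x := by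
      intro x hx
      refine ((Real.hasDerivAt_rpow_const (p := N - 1) (Or.inl hx.ne')).mul (hA x hx)).congr_deriv ?_
      rw [Real.rpow_sub_one hx.ne']
      field_simp
      ring
    refine monotoneOn_of_deriv_nonneg (convex_Ioi 0)
      (fun x hx => (hd x hx).continuousAt.continuousWithinAt)
      (fun x hx => (hd x (by simpa using hx)).differentiableAt.differentiableWithinAt) ?_
    intro x hx
    have hx : 0 < x := by simpa using hx
    rw [(hd x hx).deriv]
    exact mul_nonneg (by positivity) (hg x hx)
  obtain ⟨ξ, hξ, h⟩ := exists_hasDerivAt_eq_slope u (fun x => -(A x) ^ m)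
    (show r < 2 * r by linarith)
    (fun x hx => (hu x (hr.trans_le hx.1)).continuousAt.continuousWithinAt)
    (fun x hx => hu x (hr.trans hx.1))
  have hξ0 : 0 < ξ := hr.trans hξ.1
  have h1 : u r = u (2 * r) + r * A ξ ^ m := by
    field_simp at h
    linarith
  have h2 : r ^ (N - 1) * A r ≤ ξ ^ (N - 1) * A ξ := hflux hr hξ0 hξ.1.le
  have h3 : ξ ^ (N - 1) ≤ 2 ^ (N - 1) * r ^ (N - 1) := by
    rw [← Real.mul_rpow (by norm_num) hr.le]
    exact Real.rpow_le_rpow hξ0.le hξ.2.le (by linarith)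
  have h4 : A r ≤ 2 ^ (N - 1) * A ξ := by
    have hp : 0 < r ^ (N - 1) := by positivity
    have := mul_le_mul_of_nonneg_right h3 (hA0 ξ hξ0).le
    nlinarith
  have h5 : 2 ^ (-(N - 1)) * A r ≤ A ξ := by
    rw [Real.rpow_neg (by norm_num), inv_mul_le_iff₀ (by positivity)]
    exact h4
  have h6 : (2 ^ (-(N - 1)) * A r) ^ m ≤ A ξ ^ m :=
    Real.rpow_le_rpow (mul_nonneg (by positivity) (hA0 r hr).le) h5 hm.le
  have := hu0 (2 * r) (by positivity)
  nlinarith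

lemma log_flux_lower {u A B : ℝ → ℝ} {g : ℝ → ℝ} {N m μ r : ℝ} (hN : 1 ≤ N) (hm : 0 < m)
    (hμ : 0 < μ) (hr : 0 < r) (hu0 : ∀ x, 0 < x → 0 < u x) (hA0 : ∀ x, 0 < x → 0 < A x)
    (hB0 : 0 < B r)
    (hg : ∀ x, 0 < x → 0 ≤ g x) (hu : ∀ x, 0 < x → HasDerivAt u (-(A x) ^ m) x)
    (hA : ∀ x, 0 < x → HasDerivAt A (g x - (N - 1) * A x / x) x)
    (hY : r * u r ^ μ ≤ N * B r) :
    (1 + μ) * Real.log r + m * μ * Real.log (A r)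
      - (Real.log N + m * μ * (N - 1) * Real.log 2) ≤ Real.log (B r) := by
  have h := mul_rpow_le_of_radial hN hm hr hu0 hA0 hg hu hA
  have hAr := hA0 r hr
  have hur := hu0 r hr
  have h1 := Real.log_le_log (by positivity) h
  rw [Real.log_mul hr.ne' (by positivity), Real.log_rpow (by positivity),
    Real.log_mul (by positivity) hAr.ne', Real.log_rpow (by norm_num)] at h1
  have h2 := Real.log_le_log (by positivity) hY
  rw [Real.log_mul hr.ne' (by positivity), Real.log_mul (by positivity) hB0.ne',
    Real.log_rpow hur] at h2
  nlinarith [mul_le_mul_of_nonneg_left h1 hμ.le]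

/-- The growth exponent comparison behind the decay of the energy. -/
lemma energy_exponent_pos {N m n δ μ : ℝ} (hδ : 0 < δ) (hμ : 0 < μ)
    (hm : 0 < m) (hn : 0 < n) (hm1 : m ≤ 1) (hn1 : n ≤ 1) (hD : 1 < m * n * δ * μ)
    (hsub : 0 < N * (1 / (1 + δ) + 1 / (1 + μ)) - (N - 1 - min m n)) :
    0 < (1 + n * δ) * (1 + μ) + (1 + m * μ) * (1 + δ)
      - (m * n * δ * μ - 1) * (N - 1 + min m n) := by
  set θ := min m n with hθ
  have hθ1 : θ ≤ 1 := (min_le_left _ _).trans hm1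
  have hmn : m * n ≤ 1 := by nlinarith
  have hδμ : 1 < δ * μ := by
    have : 0 < δ * μ := by positivity
    nlinarith
  have hmn0 : 0 < m * n := by positivity
  set W := (1 + δ) * (1 + μ) with hW
  have hW0 : 0 < W := by positivity
  have hN : N * (δ * μ - 1) < (1 + θ) * W := by
    have h := mul_pos hsub hW0
    have e : (N * (1 / (1 + δ) + 1 / (1 + μ)) - (N - 1 - θ)) * W
        = (1 + θ) * W - N * (δ * μ - 1) := by
      rw [hW]; field_simp; ring
    linarith
  have h1 : (m + n) * W ≤ (1 + n * δ) * (1 + μ) + (1 + m * μ) * (1 + δ) := by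
    rw [hW]
    have : 0 ≤ (1 - n) * (1 + μ) := mul_nonneg (by linarith) (by linarith)
    have : 0 ≤ (1 - m) * (1 + δ) := mul_nonneg (by linarith) (by linarith)
    nlinarith
  have h2 : (1 + θ) * (m * n) ≤ m + n := by
    rcases le_total m n with h | h
    · rw [hθ, min_eq_left h]; nlinarith [mul_nonneg hm.le (sub_nonneg.2 hn1)]
    · rw [hθ, min_eq_right h]; nlinarith [mul_nonneg hn.le (sub_nonneg.2 hm1)]
  have hDle : m * n * δ * μ - 1 ≤ m * n * (δ * μ - 1) := by nlinarith
  by_cases hNθ : N - 1 + θ ≤ 0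
  · have : (m * n * δ * μ - 1) * (N - 1 + θ) ≤ 0 :=
      mul_nonpos_of_nonneg_of_nonpos (by linarith) hNθ
    have : 0 < (m + n) * W := by positivity
    linarith
  · push Not at hNθ
    calc 0 < (m + n) * W - m * n * (N * (δ * μ - 1)) := by
            have := mul_lt_mul_of_pos_left hN hmn0
            have := mul_le_mul_of_nonneg_right h2 hW0.le
            nlinarith
      _ ≤ (m + n) * W - (m * n * (δ * μ - 1)) * (N - 1 + θ) := by
            have : 0 ≤ m * n * (δ * μ - 1) := mul_nonneg hmn0.le (by linarith)
            nlinarith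
      _ ≤ _ := by
            have := mul_le_mul_of_nonneg_right hDle hNθ.le
            linarith

/-- Nonexistence of global positive radial solutions. -/
theorem radial_liouville {u v A B : ℝ → ℝ} {N m n δ μ : ℝ} (hN : 2 ≤ N) (hδ : 0 < δ) (hμ : 0 < μ)
    (hm : 0 < m) (hn : 0 < n) (hm1 : m ≤ 1) (hn1 : n ≤ 1) (hD : 1 < m * n * δ * μ)
    (hsub : 0 < N * (1 / (1 + δ) + 1 / (1 + μ)) - (N - 1 - min m n))
    (hu0 : ∀ r, 0 < r → 0 < u r) (hv0 : ∀ r, 0 < r → 0 < v r)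
    (hu1 : ∀ r, 0 < r → u r ≤ 1) (hv1 : ∀ r, 0 < r → v r ≤ 1)
    (hA0 : ∀ r, 0 < r → 0 < A r) (hB0 : ∀ r, 0 < r → 0 < B r)
    (hAr : ∀ r, 0 < r → A r ≤ r) (hBr : ∀ r, 0 < r → B r ≤ r)
    (hu : ∀ r, 0 < r → HasDerivAt u (-(A r) ^ m) r)
    (hv : ∀ r, 0 < r → HasDerivAt v (-(B r) ^ n) r)
    (hA : ∀ r, 0 < r → HasDerivAt A (v r ^ δ - (N - 1) * A r / r) r)
    (hB : ∀ r, 0 < r → HasDerivAt B (u r ^ μ - (N - 1) * B r / r) r)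
    (hX : ∀ r, 0 < r → r * v r ^ δ ≤ N * A r) (hY : ∀ r, 0 < r → r * u r ^ μ ≤ N * B r) :
    False := by
  set E := radialEnergy N m n δ μ u v A B with hE
  have hdE : ∀ r, 0 < r → ∃ e, 0 < e ∧ HasDerivAt E e r := fun r hr =>
    hasDerivAt_radialEnergy_pos hr hδ hμ hm1 hn1 (hu0 r hr) (hv0 r hr) (hA0 r hr) (hB0 r hr)
      (hu r hr) (hv r hr) (hA r hr) (hB r hr) (hX r hr) (hY r hr) hsub
  have hmono : StrictMonoOn E (Ioi 0) := by
    refine strictMonoOn_of_deriv_pos (convex_Ioi 0) (fun x hx => ?_) (fun x hx => ?_)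
    · obtain ⟨e, _, he⟩ := hdE x hx
      exact he.continuousAt.continuousWithinAt
    · obtain ⟨e, h0, he⟩ := hdE x (by simpa using hx)
      rwa [he.deriv]
  set θ := min m n with hθ
  have hθ0 : 0 < θ := lt_min hm hn
  have hlow : ∀ r, 0 < r → r ≤ 1 → -(2 * N) * r ≤ E r := by
    intro r hr hr1
    have hP0 : 0 < r ^ (N - 2 + θ) := by positivity
    have hP1 : r ^ (N - 2 + θ) ≤ 1 := Real.rpow_le_one hr.le hr1 (by linarith)
    have term : ∀ (w C F g a : ℝ) (s : ℝ), 0 < a → 0 < w → w ≤ 1 → 0 < C → C ≤ r → s ≤ 1 →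
        0 ≤ g → F ≤ r → r * g ≤ N * F →
        1 / (1 + a) * (w * C ^ (1 - s) * (N * F - r * g)) ≤ N * r := by
      intro w C F g a s ha hw hw1 hC hCr hs hg hF hle
      have h1 : 1 / (1 + a) ≤ 1 := by rw [div_le_one (by linarith)]; linarith
      have h2 : C ^ (1 - s) ≤ 1 := Real.rpow_le_one hC.le (hCr.trans hr1) (by linarith)
      have h3 : N * F - r * g ≤ N * r := by nlinarith [mul_nonneg hr.le hg]
      have h4 : w * C ^ (1 - s) ≤ 1 := mul_le_one₀ hw1 (by positivity) h2
      have h5 : w * C ^ (1 - s) * (N * F - r * g) ≤ N * F - r * g :=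
        mul_le_of_le_one_left (by linarith) h4
      have h6 : 0 ≤ w * C ^ (1 - s) * (N * F - r * g) :=
        mul_nonneg (by positivity) (by linarith)
      exact ((mul_le_of_le_one_left h6 h1).trans h5).trans h3
    have t1 := term (v r) (B r) (A r) (v r ^ δ) δ n hδ (hv0 r hr) (hv1 r hr) (hB0 r hr) (hBr r hr)
      hn1 (Real.rpow_nonneg (hv0 r hr).le _) (hAr r hr) (hX r hr)
    have t2 := term (u r) (A r) (B r) (u r ^ μ) μ m hμ (hu0 r hr) (hu1 r hr) (hA0 r hr) (hAr r hr)
      hm1 (Real.rpow_nonneg (hu0 r hr).le _) (hBr r hr) (hY r hr)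
    have hAB : 0 ≤ r * (A r * B r) := mul_nonneg hr.le (mul_nonneg (hA0 r hr).le (hB0 r hr).le)
    have hge : -(2 * N) * r ≤ r * (A r * B r)
      - 1 / (1 + δ) * (v r * B r ^ (1 - n) * (N * A r - r * v r ^ δ))
      - 1 / (1 + μ) * (u r * A r ^ (1 - m) * (N * B r - r * u r ^ μ)) := by linarith
    have hNr : 0 ≤ 2 * N * r := by positivity
    calc -(2 * N) * r ≤ r ^ (N - 2 + θ) * (-(2 * N) * r) := by nlinarith
      _ ≤ E r := mul_le_mul_of_nonneg_left hge hP0.le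
  have hhalf : 0 ≤ E (1 / 2) := by
    by_contra! hneg
    set r := min (1 / 4) (-E (1 / 2) / (4 * N)) with hrdef
    have hr0 : 0 < r := lt_min (by norm_num) (div_pos (by linarith) (by linarith))
    have hr4 : r ≤ 1 / 4 := min_le_left _ _
    have hrE : r ≤ -E (1 / 2) / (4 * N) := min_le_right _ _
    rw [le_div_iff₀ (by linarith)] at hrE
    have h1 := hlow r hr0 (by linarith)
    have h2 := hmono (show r ∈ Ioi 0 from hr0) (show (1 / 2 : ℝ) ∈ Ioi 0 by norm_num) (by linarith)
    nlinarith
  have hE1 : 0 < E 1 :=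
    hhalf.trans_lt (hmono (show (1 / 2 : ℝ) ∈ Ioi 0 by norm_num)
      (show (1 : ℝ) ∈ Ioi 0 by norm_num) (by norm_num))
  have hup : ∀ r, 1 ≤ r → E 1 ≤ r ^ (N - 1 + θ) * (A r * B r) := by
    intro r hr
    have hr0 : 0 < r := by linarith
    have h1 : E 1 ≤ E r := hmono.monotoneOn (show (1 : ℝ) ∈ Ioi 0 by norm_num) hr0 hr
    refine h1.trans ?_
    have e : r ^ (N - 1 + θ) = r ^ (N - 2 + θ) * r := by
      rw [← Real.rpow_add_one hr0.ne']; ring_nf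
    rw [e, mul_assoc]
    refine mul_le_mul_of_nonneg_left ?_ (by positivity)
    have t1 : 0 ≤ 1 / (1 + δ) * (v r * B r ^ (1 - n) * (N * A r - r * v r ^ δ)) := by
      have := hX r hr0; have := hv0 r hr0; have := hB0 r hr0
      exact mul_nonneg (by positivity) (mul_nonneg (by positivity) (by linarith))
    have t2 : 0 ≤ 1 / (1 + μ) * (u r * A r ^ (1 - m) * (N * B r - r * u r ^ μ)) := by
      have := hY r hr0; have := hu0 r hr0; have := hA0 r hr0
      exact mul_nonneg (by positivity) (mul_nonneg (by positivity) (by linarith))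
    linarith
  have hG := energy_exponent_pos hδ hμ hm hn hm1 hn1 hD hsub
  rw [← hθ] at hG
  set D := m * n * δ * μ - 1 with hDdef
  set G := (1 + n * δ) * (1 + μ) + (1 + m * μ) * (1 + δ) - D * (N - 1 + θ) with hGdef
  set C₁ := Real.log N + m * μ * (N - 1) * Real.log 2
  set C₂ := Real.log N + n * δ * (N - 1) * Real.log 2
  set C := (1 + n * δ) * C₁ + (1 + m * μ) * C₂ with hC
  have hfin : ∀ ℓ, 0 ≤ ℓ → D * Real.log (E 1) + G * ℓ ≤ C := by
    intro ℓ hℓ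
    set r := Real.exp ℓ with hr
    have hr0 : 0 < r := Real.exp_pos _
    have hlr : Real.log r = ℓ := Real.log_exp ℓ
    have hA' := hA0 r hr0
    have hB' := hB0 r hr0
    have h1 := log_flux_lower (by linarith) hm hμ hr0 hu0 hA0 (hB0 r hr0)
      (fun x hx => Real.rpow_nonneg (hv0 x hx).le _) hu hA (hY r hr0)
    have h2 := log_flux_lower (by linarith) hn hδ hr0 hv0 hB0 (hA0 r hr0)
      (fun x hx => Real.rpow_nonneg (hu0 x hx).le _) hv hB (hX r hr0)
    have h3 := Real.log_le_log hE1 (hup r (Real.one_le_exp hℓ))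
    rw [Real.log_mul (by positivity) (by positivity), Real.log_mul hA'.ne' hB'.ne',
      Real.log_rpow hr0] at h3
    rw [hlr] at h1 h2 h3
    have k1 := mul_le_mul_of_nonneg_left h1 (show 0 ≤ 1 + n * δ by positivity)
    have k2 := mul_le_mul_of_nonneg_left h2 (show 0 ≤ 1 + m * μ by positivity)
    have k3 := mul_le_mul_of_nonneg_left h3 (show 0 ≤ D by linarith)
    rw [hGdef, hC]
    rw [hDdef] at k3 ⊢
    linarith
  have h0 := hfin 0 le_rfl
  have h1 := hfin ((C - D * Real.log (E 1)) / G + 1)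
    (add_nonneg (div_nonneg (by linarith) hG.le) zero_le_one)
  rw [mul_add, mul_div_cancel₀ _ hG.ne'] at h1
  linarith

/-- `t ^ (1 - N) * ∫ σ in 0..t, σ ^ (N - 1) * g σ`, written so that it is regular at `t = 0`. -/
noncomputable def radialFlux (N : ℕ) (g : ℝ → ℝ) (t : ℝ) : ℝ :=
  t * ∫ τ in (0:ℝ)..1, τ ^ (N - 1) * g (t * τ)

/-- The radial primitive of `(radialFlux N g) ^ m`, constant on the negative axis for `0 ≤ g`. -/
noncomputable def radialPotential (N : ℕ) (m : ℝ) (g : ℝ → ℝ) (r : ℝ) : ℝ :=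
  ∫ t in (0:ℝ)..r, (max (radialFlux N g t) 0) ^ m

section
variable {N : ℕ} {m : ℝ} {g h : ℝ → ℝ}

lemma pow_mul_radialFlux (g : ℝ → ℝ) (t : ℝ) :
    t ^ (N - 1) * radialFlux N g t = ∫ σ in (0:ℝ)..t, σ ^ (N - 1) * g σ := by
  have h := intervalIntegral.mul_integral_comp_mul_left (a := 0) (b := 1) (c := t)
    (f := fun σ => σ ^ (N - 1) * g σ)
  simp only [mul_zero, mul_one] at h
  rw [← h, radialFlux]
  simp_rw [mul_pow, mul_assoc]
  rw [intervalIntegral.integral_const_mul]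
  ring

lemma continuous_radialFlux_uncurry {X : Type*} [TopologicalSpace X] {G : X → ℝ → ℝ}
    (hG : Continuous (Function.uncurry G)) :
    Continuous fun x : X × ℝ => radialFlux N (G x.1) x.2 := by
  refine continuous_snd.mul
    (intervalIntegral.continuous_parametric_intervalIntegral_of_continuous' ?_ 0 1)
  have : Continuous fun y : (X × ℝ) × ℝ => Function.uncurry G (y.1.1, y.1.2 * y.2) :=
    hG.comp (by fun_prop)
  exact Continuous.mul (by fun_prop) this

lemma continuous_radialFlux (hg : Continuous g) : Continuous (radialFlux N g) := by
  have : Continuous (Function.uncurry fun _ : Unit => g) := hg.comp continuous_snd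
  exact (continuous_radialFlux_uncurry this).comp (f := fun t : ℝ => ((), t)) (by fun_prop)

lemma continuous_radialPotential_uncurry {X : Type*} [TopologicalSpace X] (hm : 0 < m)
    {G : X → ℝ → ℝ} (hG : Continuous (Function.uncurry G)) :
    Continuous fun x : X × ℝ => radialPotential N m (G x.1) x.2 := by
  have h1 : Continuous (Function.uncurry fun (x : X) t => (max (radialFlux N (G x) t) 0) ^ m) :=
    ((continuous_radialFlux_uncurry hG).max continuous_const).rpow_const
      (fun _ => Or.inr hm.le)
  exact intervalIntegral.continuous_parametric_primitive_of_continuous h1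

lemma radialFlux_nonpos (hg : ∀ t, 0 ≤ g t) {t : ℝ} (ht : t ≤ 0) : radialFlux N g t ≤ 0 :=
  mul_nonpos_of_nonpos_of_nonneg ht (intervalIntegral.integral_nonneg zero_le_one
    fun _ hτ => mul_nonneg (pow_nonneg hτ.1 _) (hg _))

lemma radialFlux_le (hgc : Continuous g) (hg1 : ∀ t, g t ≤ 1) {t : ℝ} (ht : 0 ≤ t) :
    radialFlux N g t ≤ t := by
  refine mul_le_of_le_one_right ht ?_
  calc ∫ τ in (0:ℝ)..1, τ ^ (N - 1) * g (t * τ) ≤ ∫ τ in (0:ℝ)..1, (1:ℝ) := by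
        refine intervalIntegral.integral_mono_on zero_le_one
          (Continuous.intervalIntegrable (by fun_prop) _ _) (by simp) fun τ hτ => ?_
        exact (mul_le_of_le_one_right (pow_nonneg hτ.1 _) (hg1 _)).trans
          (pow_le_one₀ hτ.1 hτ.2)
    _ = 1 := by simp

lemma max_radialFlux_rpow_nonneg (t : ℝ) : 0 ≤ (max (radialFlux N g t) 0) ^ m :=
  Real.rpow_nonneg (le_max_right _ _) _

lemma max_radialFlux_rpow_le (hgc : Continuous g) (hg0 : ∀ t, 0 ≤ g t) (hg1 : ∀ t, g t ≤ 1)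
    (hm : 0 < m) (hm1 : m ≤ 1) {t T : ℝ} (hT : 0 ≤ T) (ht : t ≤ T) :
    (max (radialFlux N g t) 0) ^ m ≤ 1 + T := by
  have h1 : max (radialFlux N g t) 0 ≤ 1 + T := by
    refine max_le ?_ (by linarith)
    rcases le_total 0 t with h | h
    · exact (radialFlux_le hgc hg1 h).trans (by linarith)
    · exact (radialFlux_nonpos hg0 h).trans (by linarith)
  calc (max (radialFlux N g t) 0) ^ m ≤ (1 + T) ^ m :=
        Real.rpow_le_rpow (le_max_right _ _) h1 hm.le
    _ ≤ (1 + T) ^ (1:ℝ) := Real.rpow_le_rpow_of_exponent_le (by linarith) hm1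
    _ = 1 + T := Real.rpow_one _

lemma continuous_max_radialFlux_rpow (hm : 0 < m) (hg : Continuous g) :
    Continuous fun t => (max (radialFlux N g t) 0) ^ m :=
  ((continuous_radialFlux hg).max continuous_const).rpow_const fun _ => Or.inr hm.le

lemma hasDerivAt_radialPotential (hm : 0 < m) (hg : Continuous g) (r : ℝ) :
    HasDerivAt (radialPotential N m g) ((max (radialFlux N g r) 0) ^ m) r :=
  (continuous_max_radialFlux_rpow hm hg).integral_hasStrictDerivAt 0 r |>.hasDerivAt

lemma monotone_radialPotential (hm : 0 < m) (hg : Continuous g) :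
    Monotone (radialPotential N m g) :=
  monotone_of_deriv_nonneg (fun r => (hasDerivAt_radialPotential hm hg r).differentiableAt)
    fun r => by
      rw [(hasDerivAt_radialPotential hm hg r).deriv]
      exact max_radialFlux_rpow_nonneg r

lemma radialPotential_zero : radialPotential N m g 0 = 0 := by simp [radialPotential]

lemma radialPotential_of_nonpos (hm : 0 < m) (hg : ∀ t, 0 ≤ g t) {r : ℝ} (hr : r ≤ 0) :
    radialPotential N m g r = 0 := by
  rw [radialPotential, intervalIntegral.integral_symm, neg_eq_zero]
  refine (intervalIntegral.integral_congr (g := fun _ => (0:ℝ)) fun t ht => ?_).trans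
    intervalIntegral.integral_zero
  rw [uIcc_of_le hr] at ht
  simp only [max_eq_right (radialFlux_nonpos hg ht.2), Real.zero_rpow hm.ne']

lemma radialPotential_nonneg (hm : 0 < m) (hg : ∀ t, 0 ≤ g t) (r : ℝ) :
    0 ≤ radialPotential N m g r := by
  rcases le_total 0 r with h | h
  · exact intervalIntegral.integral_nonneg h fun t _ => max_radialFlux_rpow_nonneg t
  · exact (radialPotential_of_nonpos hm hg h).ge

lemma radialFlux_congr {r : ℝ} (hr : 0 ≤ r) (hgh : ∀ t ≤ r, g t = h t) :
    radialFlux N g r = radialFlux N h r := by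
  rw [radialFlux, radialFlux]
  congr 1
  refine intervalIntegral.integral_congr fun τ hτ => ?_
  rw [uIcc_of_le zero_le_one] at hτ
  simp only [hgh (r * τ) (mul_le_of_le_one_right hr hτ.2)]

lemma radialPotential_congr (hm : 0 < m) (hg : ∀ t, 0 ≤ g t) (hh : ∀ t, 0 ≤ h t) {r : ℝ}
    (hgh : ∀ t ≤ r, g t = h t) : radialPotential N m g r = radialPotential N m h r := by
  rcases le_total r 0 with hr | hr
  · rw [radialPotential_of_nonpos hm hg hr, radialPotential_of_nonpos hm hh hr]
  · refine intervalIntegral.integral_congr fun t ht => ?_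
    rw [uIcc_of_le hr] at ht
    simp only [radialFlux_congr ht.1 fun s hs => hgh s (hs.trans ht.2)]

lemma radialPotential_lipschitz (hgc : Continuous g) (hg0 : ∀ t, 0 ≤ g t) (hg1 : ∀ t, g t ≤ 1)
    (hm : 0 < m) (hm1 : m ≤ 1) {x y T : ℝ} (hT : 0 ≤ T) (hx : x ≤ T) (hy : y ≤ T) :
    |radialPotential N m g x - radialPotential N m g y| ≤ (1 + T) * |x - y| :=
  Convex.norm_image_sub_le_of_norm_hasDerivWithin_le
    (fun t _ => (hasDerivAt_radialPotential hm hgc t).hasDerivWithinAt)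
    (fun t ht => by
      rw [Real.norm_of_nonneg (max_radialFlux_rpow_nonneg t)]
      exact max_radialFlux_rpow_le hgc hg0 hg1 hm hm1 hT ht) (convex_Iic T) hy hx

lemma tendsto_radialFlux {G : ℕ → ℝ → ℝ} (hGc : ∀ n, Continuous (G n))
    (hG0 : ∀ n t, 0 ≤ G n t) (hG1 : ∀ n t, G n t ≤ 1)
    (hlim : ∀ t, Tendsto (fun n => G n t) atTop (𝓝 (g t))) (t : ℝ) :
    Tendsto (fun n => radialFlux N (G n) t) atTop (𝓝 (radialFlux N g t)) := by
  refine Tendsto.const_mul t (intervalIntegral.tendsto_integral_filter_of_dominated_convergence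
    (fun _ => 1) (Eventually.of_forall fun n => ?_) (Eventually.of_forall fun n => ?_) (by simp)
    ?_)
  · have := hGc n
    exact Continuous.aestronglyMeasurable (by fun_prop)
  · refine Eventually.of_forall fun τ hτ => ?_
    rw [uIoc_of_le zero_le_one] at hτ
    rw [Real.norm_of_nonneg (mul_nonneg (pow_nonneg hτ.1.le _) (hG0 _ _))]
    exact mul_le_one₀ (pow_le_one₀ hτ.1.le hτ.2) (hG0 _ _) (hG1 _ _)
  · exact Eventually.of_forall fun τ _ => (hlim _).const_mul _

lemma tendsto_radialPotential (hm : 0 < m) (hm1 : m ≤ 1) {G : ℕ → ℝ → ℝ}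
    (hGc : ∀ n, Continuous (G n)) (hG0 : ∀ n t, 0 ≤ G n t) (hG1 : ∀ n t, G n t ≤ 1)
    (hlim : ∀ t, Tendsto (fun n => G n t) atTop (𝓝 (g t))) (r : ℝ) :
    Tendsto (fun n => radialPotential N m (G n) r) atTop (𝓝 (radialPotential N m g r)) := by
  refine intervalIntegral.tendsto_integral_filter_of_dominated_convergence
    (fun _ => 1 + |r|) (Eventually.of_forall fun n => ?_) (Eventually.of_forall fun n => ?_)
    (by simp) ?_
  · exact (continuous_max_radialFlux_rpow hm (hGc n)).aestronglyMeasurable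
  · refine Eventually.of_forall fun t ht => ?_
    rw [Real.norm_of_nonneg (max_radialFlux_rpow_nonneg t)]
    refine max_radialFlux_rpow_le (hGc n) (hG0 n) (hG1 n) hm hm1 (abs_nonneg r) (ht.2.trans ?_)
    exact max_le (abs_nonneg r) (le_abs_self r)
  · exact Eventually.of_forall fun t _ =>
      ((tendsto_radialFlux hGc hG0 hG1 hlim t).max tendsto_const_nhds).rpow_const
        (Or.inr hm.le)

end

section
variable {N : ℕ} {m : ℝ} {g : ℝ → ℝ}

lemma radialFlux_pos (hgc : Continuous g) (hg : ∀ t, 0 ≤ g t) (hg0 : 0 < g 0) {t : ℝ}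
    (ht : 0 < t) : 0 < radialFlux N g t := by
  refine mul_pos ht (intervalIntegral.integral_pos zero_lt_one
    (Continuous.continuousOn (by fun_prop))
    (fun τ hτ => mul_nonneg (pow_nonneg hτ.1.le _) (hg _)) ?_)
  have h1 : ∀ᶠ τ in 𝓝[>] (0:ℝ), 0 < g (t * τ) := by
    have : ContinuousAt (fun τ => g (t * τ)) 0 := Continuous.continuousAt (by fun_prop)
    exact nhdsWithin_le_nhds (this.eventually_const_lt (by simpa using hg0))
  obtain ⟨τ, h, hτ⟩ := (h1.and (Ioo_mem_nhdsGT zero_lt_one)).exists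
  exact ⟨τ, ⟨hτ.1.le, hτ.2.le⟩, mul_pos (pow_pos hτ.1 _) h⟩

lemma strictMonoOn_radialPotential (hm : 0 < m) (hgc : Continuous g) (hg : ∀ t, 0 ≤ g t)
    (hg0 : 0 < g 0) : StrictMonoOn (radialPotential N m g) (Ici 0) := by
  refine strictMonoOn_of_deriv_pos (convex_Ici 0)
    (fun x _ => (hasDerivAt_radialPotential hm hgc x).continuousAt.continuousWithinAt)
    fun x hx => ?_
  rw [interior_Ici] at hx
  rw [(hasDerivAt_radialPotential hm hgc x).deriv]
  exact Real.rpow_pos_of_pos (lt_max_of_lt_left (radialFlux_pos hgc hg hg0 hx)) _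

end

/-- A bounded, locally equi-Lipschitz sequence has a pointwise convergent subsequence. -/
lemma exists_subseq_tendsto_of_lipschitz {f : ℕ → ℝ → ℝ} {b C : ℝ → ℝ}
    (hb : ∀ n r, |f n r| ≤ b r)
    (hlip : ∀ n T x y, 0 ≤ T → x ≤ T → y ≤ T → |f n x - f n y| ≤ C T * |x - y|) :
    ∃ φ : ℕ → ℕ, StrictMono φ ∧ ∃ F : ℝ → ℝ, ∀ r, Tendsto (fun n => f (φ n) r) atTop (𝓝 (F r)) := by
  have hcomp : IsCompact (Set.pi univ fun q : ℚ => Icc (-b q) (b q)) :=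
    isCompact_univ_pi fun q => isCompact_Icc
  obtain ⟨F₀, -, φ, hφ, hF₀⟩ := hcomp.tendsto_subseq (x := fun n (q : ℚ) => f n q)
    fun n q _ => abs_le.1 (hb n q)
  rw [tendsto_pi_nhds] at hF₀
  refine ⟨φ, hφ, ?_⟩
  have hc : ∀ r, CauchySeq fun n => f (φ n) r := by
    intro r
    rw [Metric.cauchySeq_iff']
    intro ε hε
    set T := |r| + 1 with hT
    have hT0 : 0 ≤ T := by positivity
    set K := |C T| + 1 with hK
    have hK0 : 0 < K := by positivity
    have hη : 0 < min 1 (ε / (3 * K)) := lt_min one_pos (by positivity)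
    obtain ⟨q, hq1, hq2⟩ := exists_rat_btwn (show r < r + min 1 (ε / (3 * K)) by linarith)
    have hqT : (q : ℝ) ≤ T := by
      have := min_le_left 1 (ε / (3 * K)); have := le_abs_self r
      linarith
    have hrT : r ≤ T := by have := le_abs_self r; linarith
    have hclose : ∀ n, |f n r - f n q| ≤ ε / 3 := by
      intro n
      calc |f n r - f n q| ≤ C T * |r - q| := hlip n T r q hT0 hrT hqT
        _ ≤ K * (ε / (3 * K)) := by
          have h1 : |r - q| ≤ ε / (3 * K) := by
            rw [abs_sub_comm, abs_of_pos (by linarith)]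
            have := min_le_right 1 (ε / (3 * K))
            linarith
          have h2 : C T ≤ K := (le_abs_self _).trans (by linarith)
          exact mul_le_mul h2 h1 (abs_nonneg _) hK0.le
        _ = ε / 3 := by field_simp
    obtain ⟨n₀, hn₀⟩ := Metric.cauchySeq_iff'.1 (hF₀ q).cauchySeq (ε / 3) (by positivity)
    refine ⟨n₀, fun n hn => ?_⟩
    have h1 := hn₀ n hn
    simp only [Function.comp, Real.dist_eq] at h1 ⊢
    have h2 := hclose (φ n)
    have h3 := hclose (φ n₀)
    rw [abs_lt] at h1 ⊢
    rw [abs_le] at h2 h3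
    constructor <;> linarith [h1.1, h1.2, h2.1, h2.2, h3.1, h3.2]
  exact ⟨fun r => (cauchySeq_tendsto_of_complete (hc r)).choose,
    fun r => (cauchySeq_tendsto_of_complete (hc r)).choose_spec⟩

/-- Initial values `(s, 1 - s)` of the two components. -/
def shotData (s : ℝ) (i : Bool) : ℝ := if i then s else 1 - s

lemma shotData_not (s : ℝ) (i : Bool) : shotData s (!i) = 1 - shotData s i := by
  cases i <;> simp [shotData]

lemma shotData_mem {s : ℝ} (hs : s ∈ Icc (0:ℝ) 1) (i : Bool) : shotData s i ∈ Icc (0:ℝ) 1 := by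
  cases i <;> simp [shotData, hs.1, hs.2]

/-- The power nonlinearity extended by zero to negative arguments. -/
noncomputable def posPow (γ x : ℝ) : ℝ := (max x 0) ^ γ

section
variable {γ x : ℝ}

lemma posPow_nonneg : 0 ≤ posPow γ x := Real.rpow_nonneg (le_max_right _ _) _

lemma posPow_le_one (hγ : 0 < γ) (hx : x ≤ 1) : posPow γ x ≤ 1 :=
  Real.rpow_le_one (le_max_right _ _) (max_le hx zero_le_one) hγ.le

lemma posPow_of_pos (hx : 0 < x) : posPow γ x = x ^ γ := by rw [posPow, max_eq_left hx.le]

lemma posPow_of_nonpos (hγ : 0 < γ) (hx : x ≤ 0) : posPow γ x = 0 := by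
  rw [posPow, max_eq_right hx, Real.zero_rpow hγ.ne']

lemma continuous_posPow (hγ : 0 < γ) : Continuous (posPow γ) :=
  (continuous_id.max continuous_const).rpow_const fun _ => Or.inr hγ.le

lemma posPow_mul {c : ℝ} (hc : 0 ≤ c) : posPow γ (c * x) = c ^ γ * posPow γ x := by
  rw [posPow, posPow, ← Real.mul_rpow hc (le_max_right _ _), mul_max_of_nonneg _ _ hc, mul_zero]

end

/-- Successive approximations of the radial system with the coupling delayed by `ε`. -/
noncomputable def delayIter (N : ℕ) (κ γ : Bool → ℝ) (ε : ℝ) : ℕ → ℝ → Bool → ℝ → ℝ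
  | 0, s, i, _ => shotData s i
  | k + 1, s, i, r => shotData s i - radialPotential N (κ i)
      (fun t => posPow (γ i) (delayIter N κ γ ε k s (!i) (t - ε))) r

section
variable {N : ℕ} {κ γ : Bool → ℝ} {ε : ℝ}

lemma continuous_shotData (i : Bool) : Continuous fun s => shotData s i := by
  cases i
  · exact continuous_const.sub continuous_id
  · exact continuous_id

lemma continuous_delayIter (hκ : ∀ i, 0 < κ i) (hγ : ∀ i, 0 < γ i) (k : ℕ) (i : Bool) :
    Continuous fun x : ℝ × ℝ => delayIter N κ γ ε k x.1 i x.2 := by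
  induction k generalizing i with
  | zero => exact (continuous_shotData i).comp continuous_fst
  | succ k ih =>
    refine ((continuous_shotData i).comp continuous_fst).sub ?_
    have h : Continuous (Function.uncurry fun s t =>
        posPow (γ i) (delayIter N κ γ ε k s (!i) (t - ε))) :=
      (continuous_posPow (hγ i)).comp
        ((ih (!i)).comp (f := fun y : ℝ × ℝ => (y.1, y.2 - ε)) (by fun_prop))
    exact continuous_radialPotential_uncurry (hκ i) h

lemma continuous_posPow_delayIter (hκ : ∀ i, 0 < κ i) (hγ : ∀ i, 0 < γ i) (k : ℕ) (s : ℝ)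
    (i : Bool) : Continuous fun t => posPow (γ i) (delayIter N κ γ ε k s (!i) (t - ε)) :=
  (continuous_posPow (hγ i)).comp ((continuous_delayIter hκ hγ k (!i)).comp
    (f := fun t : ℝ => (s, t - ε)) (by fun_prop))

lemma delayIter_le (hκ : ∀ i, 0 < κ i) (k : ℕ) (s : ℝ) (i : Bool) (r : ℝ) :
    delayIter N κ γ ε k s i r ≤ shotData s i := by
  cases k with
  | zero => exact le_rfl
  | succ k => exact sub_le_self _ (radialPotential_nonneg (hκ i) (fun _ => posPow_nonneg) r)

lemma delayIter_of_nonpos (hκ : ∀ i, 0 < κ i) (k : ℕ) (s : ℝ) (i : Bool) {r : ℝ} (hr : r ≤ 0) :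
    delayIter N κ γ ε k s i r = shotData s i := by
  cases k with
  | zero => rfl
  | succ k =>
    rw [delayIter, radialPotential_of_nonpos (hκ i) (fun _ => posPow_nonneg) hr, sub_zero]

lemma delayIter_succ_eq (hκ : ∀ i, 0 < κ i) (k : ℕ) (s : ℝ) (i : Bool) {r : ℝ}
    (hr : r ≤ k * ε) : delayIter N κ γ ε (k + 1) s i r = delayIter N κ γ ε k s i r := by
  induction k generalizing i r with
  | zero =>
    have hr : r ≤ 0 := by simpa using hr
    rw [delayIter_of_nonpos hκ _ _ _ hr, delayIter_of_nonpos hκ _ _ _ hr]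
  | succ k ih =>
    rw [delayIter, delayIter]
    congr 1
    refine radialPotential_congr (hκ i) (fun _ => posPow_nonneg) (fun _ => posPow_nonneg)
      fun t ht => ?_
    rw [ih]
    push_cast at hr
    linarith

lemma delayIter_of_shotData_eq_zero (hκ : ∀ i, 0 < κ i) (hγ : ∀ i, 0 < γ i) {s : ℝ} {i : Bool}
    (hs : shotData s i = 0) (k : ℕ) (r : ℝ) : delayIter N κ γ ε k s (!i) r = 1 := by
  have h1 : shotData s (!i) = 1 := by rw [shotData_not, hs, sub_zero]
  cases k with
  | zero => exact h1
  | succ k =>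
    rw [delayIter, h1, sub_eq_self]
    have : (fun t => posPow (γ !i) (delayIter N κ γ ε k s (!(!i)) (t - ε))) = fun _ => 0 := by
      funext t
      rw [Bool.not_not]
      exact posPow_of_nonpos (hγ _) ((delayIter_le hκ k s i _).trans hs.le)
    rw [this]
    simp [radialPotential, radialFlux, Real.zero_rpow (hκ _).ne']

lemma delayIter_neg_of_shotData_eq_zero (hκ : ∀ i, 0 < κ i) (hγ : ∀ i, 0 < γ i) {s : ℝ}
    {i : Bool} (hs : shotData s i = 0) (k : ℕ) {r : ℝ} (hr : 0 < r) :
    delayIter N κ γ ε (k + 1) s i r < 0 := by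
  rw [delayIter, hs]
  have : (fun t => posPow (γ i) (delayIter N κ γ ε k s (!i) (t - ε))) = fun _ => 1 := by
    funext t
    rw [delayIter_of_shotData_eq_zero hκ hγ hs, posPow_of_pos one_pos, Real.one_rpow]
  rw [this]
  have h := strictMonoOn_radialPotential (N := N) (hκ i) (continuous_const (y := (1:ℝ)))
    (fun _ => zero_le_one) one_pos (mem_Ici.2 le_rfl) (show r ∈ Ici 0 from hr.le) hr
  rw [radialPotential_zero] at h
  linarith

lemma antitone_delayIter (hκ : ∀ i, 0 < κ i) (hγ : ∀ i, 0 < γ i) (k : ℕ) (s : ℝ) (i : Bool) :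
    Antitone (delayIter N κ γ ε k s i) := by
  cases k with
  | zero => exact antitone_const
  | succ k =>
    intro x y hxy
    exact sub_le_sub_left (monotone_radialPotential (hκ i)
      (continuous_posPow_delayIter hκ hγ k s i) hxy) _

/-- For some initial value, neither component becomes negative before the other one vanishes. -/
lemma exists_shot_delayIter (hκ : ∀ i, 0 < κ i) (hγ : ∀ i, 0 < γ i) (k : ℕ) {T : ℝ} (hT : 0 < T) :
    ∃ s ∈ Icc (0:ℝ) 1, ∀ i, ∀ r ≤ T, ¬ (delayIter N κ γ ε (k + 1) s i r < 0 ∧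
      0 < delayIter N κ γ ε (k + 1) s (!i) r) := by
  set w := delayIter N κ γ ε (k + 1) with hw
  set O : Bool → Set ℝ := fun i => ⋃ r ∈ Iic T, {s | w s i r < 0 ∧ 0 < w s (!i) r} with hO
  have hc : ∀ i r, Continuous fun s => w s i r := fun i r =>
    (continuous_delayIter hκ hγ (k + 1) i).comp (f := fun s : ℝ => (s, r)) (by fun_prop)
  have hopen : ∀ i, IsOpen (O i) := fun i => isOpen_biUnion fun r _ =>
    (isOpen_lt (hc i r) continuous_const).inter (isOpen_lt continuous_const (hc (!i) r))
  have hmem : ∀ i s, shotData s i = 0 → s ∈ O i := by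
    intro i s hs
    refine mem_biUnion (x := T) (mem_Iic.2 le_rfl) ⟨?_, ?_⟩
    · exact delayIter_neg_of_shotData_eq_zero hκ hγ hs k hT
    · rw [hw, delayIter_of_shotData_eq_zero hκ hγ hs]; exact one_pos
  by_contra! hcon
  have hcover : Icc (0:ℝ) 1 ⊆ O true ∪ O false := by
    intro s hs
    obtain ⟨i, r, hr, h⟩ := hcon s hs
    have : s ∈ O i := mem_biUnion hr h
    cases i
    · exact Or.inr this
    · exact Or.inl this
  obtain ⟨s, -, h1, h2⟩ := isPreconnected_Icc (O true) (O false) (hopen _) (hopen _) hcover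
    ⟨0, by simp, hmem true 0 (by simp [shotData])⟩ ⟨1, by simp, hmem false 1 (by simp [shotData])⟩
  simp only [hO, mem_iUnion, mem_ofPred_eq, exists_prop, Bool.not_true, Bool.not_false] at h1 h2
  obtain ⟨r, -, hr1, hr2⟩ := h1
  obtain ⟨r', -, hr1', hr2'⟩ := h2
  have ha := fun i => antitone_delayIter (N := N) (ε := ε) hκ hγ (k + 1) s i
  rcases le_total r r' with h | h
  · have := ha true h; linarith
  · have := ha false h; linarith

/-- A shot of the undelayed system whose components cannot change sign one before the other. -/
theorem exists_balanced_shot (hκ : ∀ i, 0 < κ i) (hκ1 : ∀ i, κ i ≤ 1) (hγ : ∀ i, 0 < γ i) :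
    ∃ s ∈ Icc (0:ℝ) 1, ∃ w : Bool → ℝ → ℝ, (∀ i, Continuous (w i)) ∧
      (∀ i r, w i r = shotData s i
        - radialPotential N (κ i) (fun t => posPow (γ i) (w (!i) t)) r) ∧
      ∀ i r, ¬ (w i r < 0 ∧ 0 < w (!i) r) := by
  have hstep := fun n : ℕ => exists_shot_delayIter (N := N) (ε := 1 / ((n:ℝ) + 1)) hκ hγ
    ((n + 1) ^ 2) (T := (n:ℝ) + 1) (by positivity)
  choose s hs hbal using hstep
  set ε : ℕ → ℝ := fun n => 1 / ((n:ℝ) + 1) with hε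
  have hε0 : ∀ n, 0 < ε n := fun n => by rw [hε]; positivity
  set G : ℕ → Bool → ℝ → ℝ := fun n i t =>
    posPow (γ i) (delayIter N κ γ (ε n) ((n + 1) ^ 2) (s n) (!i) (t - ε n)) with hG
  set W : ℕ → Bool → ℝ → ℝ := fun n => delayIter N κ γ (ε n) ((n + 1) ^ 2 + 1) (s n) with hW
  have hWG : ∀ n i r, W n i r = shotData (s n) i - radialPotential N (κ i) (G n i) r :=
    fun n i r => rfl
  have hGc : ∀ n i, Continuous (G n i) := fun n i =>
    continuous_posPow_delayIter hκ hγ _ _ _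
  have hG0 : ∀ n i t, 0 ≤ G n i t := fun n i t => posPow_nonneg
  have hG1 : ∀ n i t, G n i t ≤ 1 := fun n i t => posPow_le_one (hγ i)
    ((delayIter_le hκ _ _ _ _).trans (shotData_mem (hs n) _).2)
  have hGW : ∀ (n : ℕ) i (t : ℝ), t ≤ n → G n i t = posPow (γ i) (W n (!i) (t - ε n)) := by
    intro n i t ht
    simp only [hG, hW]
    rw [delayIter_succ_eq hκ]
    have : (((n + 1) ^ 2 : ℕ) : ℝ) * ε n = n + 1 := by
      simp only [hε]; push_cast; field_simp
    rw [this]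
    have := hε0 n
    linarith
  have hlip : ∀ n i T x y, 0 ≤ T → x ≤ T → y ≤ T →
      |W n i x - W n i y| ≤ (1 + T) * |x - y| := by
    intro n i T x y hT hx hy
    rw [hWG, hWG, sub_sub_sub_cancel_left, abs_sub_comm x y]
    exact radialPotential_lipschitz (hGc n i) (hG0 n i) (hG1 n i) (hκ i) (hκ1 i) hT hy hx
  have hbd : ∀ n i r, |W n i r| ≤ 1 + (1 + |r|) * |r| := by
    intro n i r
    have h0 : W n i 0 = shotData (s n) i := by rw [hWG, radialPotential_zero, sub_zero]
    have h1 := hlip n i |r| r 0 (abs_nonneg r) (le_abs_self r) (abs_nonneg r)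
    have h2 := shotData_mem (hs n) i
    rw [h0, sub_zero] at h1
    rw [abs_le] at h1 ⊢
    constructor <;> linarith [h1.1, h1.2, h2.1, h2.2]
  obtain ⟨φ₁, hφ₁, F₁, hF₁⟩ := exists_subseq_tendsto_of_lipschitz (C := fun T => 1 + T)
    (fun n => hbd n true) (fun n => hlip n true)
  obtain ⟨φ₂, hφ₂, F₂, hF₂⟩ := exists_subseq_tendsto_of_lipschitz (C := fun T => 1 + T)
    (fun n => hbd (φ₁ n) false) (fun n => hlip (φ₁ n) false)
  set φ : ℕ → ℕ := fun n => φ₁ (φ₂ n) with hφ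
  have hφm : StrictMono φ := hφ₁.comp hφ₂
  set F : Bool → ℝ → ℝ := fun i => if i then F₁ else F₂ with hFdef
  have hF : ∀ i r, Tendsto (fun n => W (φ n) i r) atTop (𝓝 (F i r)) := by
    rintro (_ | _) r
    · exact hF₂ r
    · exact (hF₁ r).comp hφ₂.tendsto_atTop
  have hFlip : ∀ i T x y, 0 ≤ T → x ≤ T → y ≤ T → |F i x - F i y| ≤ (1 + T) * |x - y| :=
    fun i T x y hT hx hy => le_of_tendsto ((hF i x).sub (hF i y)).abs
      (Eventually.of_forall fun n => hlip (φ n) i T x y hT hx hy)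
  have hFc : ∀ i, Continuous (F i) := by
    intro i
    refine continuous_iff_continuousAt.2 fun x => ?_
    have hT : 0 ≤ |x| + 1 := by positivity
    have h : LipschitzOnWith (Real.toNNReal (1 + (|x| + 1))) (F i) (Iic (|x| + 1)) :=
      LipschitzOnWith.of_dist_le_mul fun y hy z hz => by
        rw [Real.coe_toNNReal _ (by positivity)]
        exact hFlip i _ y z hT hy hz
    exact h.continuousOn.continuousAt (Iic_mem_nhds (by have := le_abs_self x; linarith))
  have hεlim : Tendsto (fun n => ε (φ n)) atTop (𝓝 0) :=
    tendsto_one_div_add_atTop_nhds_zero_nat.comp hφm.tendsto_atTop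
  have hdelay : ∀ i t, Tendsto (fun n => W (φ n) i (t - ε (φ n))) atTop (𝓝 (F i t)) := by
    intro i t
    have h1 : Tendsto (fun n => W (φ n) i (t - ε (φ n)) - W (φ n) i t) atTop (𝓝 0) := by
      have h2 : Tendsto (fun n => (1 + |t|) * ε (φ n)) atTop (𝓝 0) := by
        simpa using hεlim.const_mul (1 + |t|)
      refine squeeze_zero_norm (fun n => ?_) h2
      have h3 := hε0 (φ n)
      have h4 := hlip (φ n) i |t| (t - ε (φ n)) t (abs_nonneg t)
        (by have := le_abs_self t; linarith) (le_abs_self t)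
      rw [sub_sub_cancel_left, abs_neg, abs_of_pos h3] at h4
      exact h4
    simpa using h1.add (hF i t)
  have hGlim : ∀ i t, Tendsto (fun n => G (φ n) i t) atTop (𝓝 (posPow (γ i) (F (!i) t))) := by
    intro i t
    refine (((continuous_posPow (hγ i)).tendsto _).comp (hdelay (!i) t)).congr' ?_
    obtain ⟨n₀, hn₀⟩ := exists_nat_ge t
    filter_upwards [eventually_ge_atTop n₀] with n hn
    refine (hGW (φ n) i t (hn₀.trans ?_)).symm
    exact_mod_cast hn.trans (hφm.id_le n)
  have hpot : ∀ i r, Tendsto (fun n => radialPotential N (κ i) (G (φ n) i) r) atTop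
      (𝓝 (radialPotential N (κ i) (fun t => posPow (γ i) (F (!i) t)) r)) := fun i r =>
    tendsto_radialPotential (hκ i) (hκ1 i) (fun n => hGc _ i) (fun n => hG0 _ i)
      (fun n => hG1 _ i) (hGlim i) r
  have hs_lim : Tendsto (fun n => s (φ n)) atTop (𝓝 (F true 0)) := by
    refine (hF true 0).congr fun n => ?_
    rw [hWG, radialPotential_zero, sub_zero]
    rfl
  refine ⟨F true 0, isClosed_Icc.mem_of_tendsto hs_lim (Eventually.of_forall fun n => hs _), F,
    hFc, fun i r => ?_, fun i r h => ?_⟩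
  · refine tendsto_nhds_unique (hF i r) ?_
    simp only [hWG]
    exact (((continuous_shotData i).tendsto _).comp hs_lim).sub (hpot i r)
  · obtain ⟨n₀, hn₀⟩ := exists_nat_ge r
    obtain ⟨n, ⟨h1, h2⟩, hn⟩ := ((((hF i r).eventually_lt_const h.1).and
      ((hF (!i) r).eventually_const_lt h.2)).and (eventually_ge_atTop n₀)).exists
    refine hbal (φ n) i r ?_ ⟨h1, h2⟩
    have : (n:ℝ) ≤ φ n := by exact_mod_cast hφm.id_le n
    have : (n₀:ℝ) ≤ n := by exact_mod_cast hn
    linarith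

end

section
variable {N : ℕ} {m : ℝ} {g : ℝ → ℝ}

lemma hasDerivAt_radialFlux (hN : 1 ≤ N) (hg : Continuous g) {r : ℝ} (hr : 0 < r) :
    HasDerivAt (radialFlux N g) (g r - ((N:ℝ) - 1) * radialFlux N g r / r) r := by
  have hc : Continuous fun σ : ℝ => σ ^ (N - 1) * g σ := by fun_prop
  have h1 := (hc.integral_hasStrictDerivAt 0 r).hasDerivAt
  have h2 := h1.div (hasDerivAt_pow (N - 1) r) (pow_ne_zero _ hr.ne')
  have he : radialFlux N g =ᶠ[𝓝 r]
      (fun t => ∫ σ in (0:ℝ)..t, σ ^ (N - 1) * g σ) / fun t => t ^ (N - 1) := by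
    filter_upwards [lt_mem_nhds hr] with t ht
    rw [Pi.div_apply, ← pow_mul_radialFlux, mul_div_cancel_left₀ _ (pow_ne_zero _ ht.ne')]
  refine (h2.congr_of_eventuallyEq he).congr_deriv ?_
  rw [← pow_mul_radialFlux]
  rcases Nat.exists_eq_add_of_le hN with ⟨k, rfl⟩
  rcases k with _ | k
  · simp
  · simp only [Nat.add_sub_cancel_left, Nat.add_sub_cancel]
    push_cast
    field_simp
    ring

lemma mul_le_radialFlux (hN : 1 ≤ N) (hgc : Continuous g) {r : ℝ} (hr : 0 < r)
    (hg : ∀ t ∈ Icc 0 r, g r ≤ g t) : r * g r ≤ N * radialFlux N g r := by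
  have h : ∫ τ in (0:ℝ)..1, τ ^ (N - 1) * g r ≤ ∫ τ in (0:ℝ)..1, τ ^ (N - 1) * g (r * τ) := by
    refine intervalIntegral.integral_mono_on zero_le_one
      (Continuous.intervalIntegrable (by fun_prop) _ _)
      (Continuous.intervalIntegrable (by fun_prop) _ _) fun τ hτ => ?_
    exact mul_le_mul_of_nonneg_left
      (hg _ ⟨mul_nonneg hr.le hτ.1, mul_le_of_le_one_right hr.le hτ.2⟩) (pow_nonneg hτ.1 _)
  rw [intervalIntegral.integral_mul_const, integral_pow, Nat.cast_sub hN] at h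
  have hN0 : (0:ℝ) < N := by exact_mod_cast hN
  have e : (((1:ℝ) ^ (N - 1 + 1) - 0 ^ (N - 1 + 1)) / ((N:ℝ) - (1:ℕ) + 1)) * g r = g r / N := by
    simp; ring
  rw [e, div_le_iff₀ hN0] at h
  rw [radialFlux]
  nlinarith

lemma radialFlux_scale {c l : ℝ} (hl : 0 < l) (t : ℝ) :
    radialFlux N (fun s => c * g (l * s)) t = c / l * radialFlux N g (l * t) := by
  rw [radialFlux, radialFlux]
  have : (fun τ => τ ^ (N - 1) * (c * g (l * (t * τ))))
      = fun τ => c * (τ ^ (N - 1) * g (l * t * τ)) := by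
    funext τ; ring_nf
  rw [this, intervalIntegral.integral_const_mul]
  field_simp

lemma radialPotential_scale {c l : ℝ} (hc : 0 ≤ c) (hl : 0 < l) (r : ℝ) :
    radialPotential N m (fun s => c * g (l * s)) r
      = (c / l) ^ m / l * radialPotential N m g (l * r) := by
  have hcl : 0 ≤ c / l := by positivity
  have : (fun t => (max (radialFlux N (fun s => c * g (l * s)) t) 0) ^ m)
      = fun t => (c / l) ^ m * (max (radialFlux N g (l * t)) 0) ^ m := by
    funext t
    rw [radialFlux_scale hl, ← Real.mul_rpow hcl (le_max_right _ _), mul_max_of_nonneg _ _ hcl,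
      mul_zero]
  rw [radialPotential, this, intervalIntegral.integral_const_mul,
    intervalIntegral.integral_comp_mul_left (fun t => (max (radialFlux N g t) 0) ^ m) hl.ne',
    mul_zero, ← radialPotential, smul_eq_mul]
  field_simp

/-- Regularity and differential equation of the radial potential. -/
lemma radialPotential_regular {u : ℝ → ℝ} {a p : ℝ} (hN : 1 ≤ N) (hp : 2 ≤ p)
    (hgc : Continuous g) (hg : ∀ t, 0 ≤ g t) (hg0 : 0 < g 0)
    (hu : ∀ r, u r = a - radialPotential N (1 / (p - 1)) g r) :
    ContDiff ℝ 1 u ∧ ContDiffOn ℝ 2 u (Ioi 0) ∧ deriv u 0 = 0 ∧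
      ∀ r, 0 < r → deriv (fun s => s ^ ((N:ℝ) - 1) * |deriv u s| ^ (p - 2) * deriv u s) r
        = -(r ^ ((N:ℝ) - 1) * g r) := by
  have hm : 0 < 1 / (p - 1) := by
    have : 0 < p - 1 := by linarith
    positivity
  have hd : ∀ r, HasDerivAt u (-(max (radialFlux N g r) 0) ^ (1 / (p - 1))) r := by
    intro r
    rw [funext hu]
    exact (hasDerivAt_radialPotential hm hgc r).const_sub a
  have hderiv : deriv u = fun r => -(max (radialFlux N g r) 0) ^ (1 / (p - 1)) :=
    funext fun r => (hd r).deriv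
  have hpos : ∀ r, 0 < r → 0 < radialFlux N g r := fun r hr => radialFlux_pos hgc hg hg0 hr
  have hflux : ContDiffOn ℝ 1 (radialFlux N g) (Ioi 0) := by
    have hdf : ∀ r, 0 < r → deriv (radialFlux N g) r
        = g r - ((N:ℝ) - 1) * radialFlux N g r / r :=
      fun r hr => (hasDerivAt_radialFlux hN hgc hr).deriv
    rw [show (1 : WithTop ℕ∞) = 0 + 1 from rfl, contDiffOn_succ_iff_deriv_of_isOpen isOpen_Ioi]
    refine ⟨fun r hr => (hasDerivAt_radialFlux hN hgc hr).differentiableAt.differentiableWithinAt,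
      by simp, ?_⟩
    rw [contDiffOn_zero]
    refine ContinuousOn.congr (f := fun r => g r - ((N:ℝ) - 1) * radialFlux N g r / r) ?_
      fun r hr => hdf r hr
    have := continuous_radialFlux (N := N) hgc
    exact hgc.continuousOn.sub ((Continuous.continuousOn (by fun_prop)).div continuousOn_id
      fun r hr => ne_of_gt hr)
  refine ⟨?_, ?_, ?_, ?_⟩
  · rw [contDiff_one_iff_deriv]
    refine ⟨fun r => (hd r).differentiableAt, ?_⟩
    rw [hderiv]
    exact (continuous_max_radialFlux_rpow hm hgc).neg
  · rw [show (2 : WithTop ℕ∞) = 1 + 1 from rfl, contDiffOn_succ_iff_deriv_of_isOpen isOpen_Ioi]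
    refine ⟨fun r _ => (hd r).differentiableAt.differentiableWithinAt, by simp, ?_⟩
    refine (hflux.rpow_const_of_ne (p := 1 / (p - 1)) fun r hr => (hpos r hr).ne').neg.congr
      fun r hr => ?_
    rw [hderiv]
    simp only [max_eq_left (hpos r hr).le]
  · rw [hderiv]
    simp [radialFlux, Real.zero_rpow (show (p - 1)⁻¹ ≠ 0 by simpa using hm.ne')]
  · intro r hr
    have hc : Continuous fun σ : ℝ => σ ^ (N - 1) * g σ := by fun_prop
    have hpow : ∀ s : ℝ, s ^ ((N:ℝ) - 1) = s ^ (N - 1) := fun s => by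
      rw [← Real.rpow_natCast, Nat.cast_sub hN, Nat.cast_one]
    have he : (fun s => s ^ ((N:ℝ) - 1) * |deriv u s| ^ (p - 2) * deriv u s) =ᶠ[𝓝 r]
        fun t => -∫ σ in (0:ℝ)..t, σ ^ (N - 1) * g σ := by
      filter_upwards [lt_mem_nhds hr] with t ht
      have hf := hpos t ht
      rw [← pow_mul_radialFlux, hderiv, hpow]
      simp only [max_eq_left hf.le, abs_neg]
      rw [abs_of_nonneg (by positivity), mul_neg, mul_assoc]
      congr 2
      rw [← Real.rpow_mul hf.le, ← Real.rpow_add hf]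
      have : 1 / (p - 1) * (p - 2) + 1 / (p - 1) = 1 := by
        have : p - 1 ≠ 0 := by linarith
        field_simp
        ring
      rw [this, Real.rpow_one]
    rw [he.deriv_eq, (hc.integral_hasStrictDerivAt 0 r).hasDerivAt.fun_neg.deriv, hpow]

end

section
variable {N : ℕ} {κ γ a : Bool → ℝ} {w : Bool → ℝ → ℝ}

/-- Integral form of the radial system, extended by zero nonlinearities past the first zero. -/
def IsRadialShot (N : ℕ) (κ γ a : Bool → ℝ) (w : Bool → ℝ → ℝ) : Prop :=
  (∀ i, Continuous (w i)) ∧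
    ∀ i r, w i r = a i - radialPotential N (κ i) (fun t => posPow (γ i) (w (!i) t)) r

lemma IsRadialShot.of_nonpos (h : IsRadialShot N κ γ a w) (hκ : ∀ i, 0 < κ i) (i : Bool) {r : ℝ}
    (hr : r ≤ 0) : w i r = a i := by
  rw [h.2, radialPotential_of_nonpos (hκ i) (fun _ => posPow_nonneg) hr, sub_zero]

lemma IsRadialShot.continuous_source (h : IsRadialShot N κ γ a w) (hγ : ∀ i, 0 < γ i) (i : Bool) :
    Continuous fun t => posPow (γ i) (w (!i) t) :=
  (continuous_posPow (hγ i)).comp (h.1 (!i))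

lemma IsRadialShot.source_zero_pos (h : IsRadialShot N κ γ a w) (hκ : ∀ i, 0 < κ i)
    (ha : ∀ i, 0 < a i) (i : Bool) : 0 < posPow (γ i) (w (!i) 0) := by
  rw [h.of_nonpos hκ (!i) le_rfl, posPow_of_pos (ha _)]
  exact Real.rpow_pos_of_pos (ha _) _

lemma IsRadialShot.antitone (h : IsRadialShot N κ γ a w) (hκ : ∀ i, 0 < κ i)
    (hγ : ∀ i, 0 < γ i) (i : Bool) : Antitone (w i) := fun x y hxy => by
  rw [h.2, h.2]
  exact sub_le_sub_left (monotone_radialPotential (hκ i) (h.continuous_source hγ i) hxy) _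

lemma IsRadialShot.strictAntiOn (h : IsRadialShot N κ γ a w) (hκ : ∀ i, 0 < κ i)
    (hγ : ∀ i, 0 < γ i) (ha : ∀ i, 0 < a i) (i : Bool) : StrictAntiOn (w i) (Ici 0) :=
  fun x hx y hy hxy => by
    rw [h.2, h.2]
    exact sub_lt_sub_left (strictMonoOn_radialPotential (hκ i) (h.continuous_source hγ i)
      (fun _ => posPow_nonneg) (h.source_zero_pos hκ ha i) hx hy hxy) _

lemma IsRadialShot.shotData_pos {s : ℝ} (h : IsRadialShot N κ γ (shotData s) w)
    (hκ : ∀ i, 0 < κ i) (hγ : ∀ i, 0 < γ i) (hs : s ∈ Icc (0:ℝ) 1)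
    (hbal : ∀ i r, ¬ (w i r < 0 ∧ 0 < w (!i) r)) (i : Bool) : 0 < shotData s i := by
  refine (shotData_mem hs i).1.lt_of_ne' fun h0 => ?_
  have h1 : ∀ r, w i r ≤ 0 := fun r => by
    rw [h.2, h0, zero_sub, neg_nonpos]
    exact radialPotential_nonneg (hκ i) (fun _ => posPow_nonneg) r
  have h2 : ∀ r, w (!i) r = 1 := fun r => by
    rw [h.2, shotData_not, h0, Bool.not_not]
    simp [posPow_of_nonpos (hγ _) (h1 _), radialPotential, radialFlux, Real.zero_rpow (hκ _).ne']
  refine hbal i 1 ⟨?_, by rw [h2]; exact one_pos⟩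
  have h3 := strictMonoOn_radialPotential (N := N) (hκ i) (h.continuous_source hγ i)
    (fun _ => posPow_nonneg) (by rw [h2, posPow_of_pos one_pos]; simp)
    (mem_Ici.2 le_rfl) (mem_Ici.2 zero_le_one) zero_lt_one
  rw [radialPotential_zero] at h3
  rw [h.2, h0]
  linarith

lemma IsRadialShot.exists_common_zero (h : IsRadialShot N κ γ a w) (hκ : ∀ i, 0 < κ i)
    (hγ : ∀ i, 0 < γ i) (ha : ∀ i, 0 < a i) (hbal : ∀ i r, ¬ (w i r < 0 ∧ 0 < w (!i) r))
    (hz : ∃ i r, w i r ≤ 0) : ∃ R, 0 < R ∧ ∀ i, w i R = 0 ∧ ∀ r < R, 0 < w i r := by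
  set Z : Set ℝ := ⋃ i, {r | w i r ≤ 0} with hZ
  have hmem : ∀ r, r ∈ Z ↔ ∃ i, w i r ≤ 0 := fun r => by simp [hZ]
  have hclosed : IsClosed Z := isClosed_iUnion_of_finite fun i => isClosed_le (h.1 i) continuous_const
  have hlow : ∀ r ∈ Z, 0 < r := by
    intro r hr
    obtain ⟨i, hi⟩ := (hmem r).1 hr
    by_contra! hneg
    rw [h.of_nonpos hκ i hneg] at hi
    exact absurd (ha i) (not_lt.2 hi)
  have hbdd : BddBelow Z := ⟨0, fun r hr => (hlow r hr).le⟩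
  have hne : Z.Nonempty := by
    obtain ⟨i, r, hr⟩ := hz
    exact ⟨r, (hmem r).2 ⟨i, hr⟩⟩
  have hR : sInf Z ∈ Z := hclosed.csInf_mem hne hbdd
  set R := sInf Z with hRdef
  have hR0 : 0 < R := hlow R hR
  have hpos : ∀ i, ∀ r < R, 0 < w i r := by
    intro i r hr
    by_contra! hneg
    exact absurd (csInf_le hbdd ((hmem r).2 ⟨i, hneg⟩)) (not_le.2 hr)
  have hnn : ∀ i, 0 ≤ w i R := fun i =>
    ge_of_tendsto (((h.1 i).tendsto R).mono_left (nhdsWithin_le_nhds (s := Iio R)))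
      (eventually_nhdsWithin_of_forall fun r hr => (hpos i r hr).le)
  obtain ⟨i, hi⟩ := (hmem R).1 hR
  have hi0 : w i R = 0 := le_antisymm hi (hnn i)
  have hni0 : w (!i) R = 0 := by
    by_contra hne0
    have hp : 0 < w (!i) R := (hnn _).lt_of_ne' hne0
    have hev : ∀ᶠ r in 𝓝[>] R, 0 < w (!i) r :=
      nhdsWithin_le_nhds ((h.1 (!i)).continuousAt.eventually_const_lt hp)
    obtain ⟨r, hr1, hr2⟩ := (hev.and self_mem_nhdsWithin).exists
    have hr2 : R < r := hr2
    have := h.strictAntiOn hκ hγ ha i (mem_Ici.2 hR0.le) (mem_Ici.2 (hR0.trans hr2).le) hr2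
    exact hbal i r ⟨by linarith, hr1⟩
  refine ⟨R, hR0, fun j => ⟨?_, hpos j⟩⟩
  rcases Bool.eq_or_eq_not j i with rfl | rfl
  · exact hi0
  · exact hni0

lemma IsRadialShot.exists_nonpos (h : IsRadialShot N κ γ a w) (hN : 2 ≤ N) (hκ : ∀ i, 0 < κ i)
    (hκ1 : ∀ i, κ i ≤ 1) (hγ : ∀ i, 0 < γ i) (ha : ∀ i, 0 < a i) (ha1 : ∀ i, a i ≤ 1)
    (hD : 1 < κ true * κ false * γ true * γ false)
    (hsub : 0 < (N:ℝ) * (1 / (1 + γ true) + 1 / (1 + γ false))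
      - ((N:ℝ) - 1 - min (κ true) (κ false))) : ∃ i r, w i r ≤ 0 := by
  by_contra! hpos
  have hN1 : 1 ≤ N := by omega
  set F : Bool → ℝ → ℝ := fun i => radialFlux N fun t => posPow (γ i) (w (!i) t) with hF
  have hg : ∀ i t, posPow (γ i) (w (!i) t) = w (!i) t ^ γ i := fun i t => posPow_of_pos (hpos _ _)
  have hw1 : ∀ i r, w i r ≤ 1 := fun i r => by
    rw [h.2]
    exact (sub_le_self _ (radialPotential_nonneg (hκ i) (fun _ => posPow_nonneg) r)).trans (ha1 i)
  have hF0 : ∀ i r, 0 < r → 0 < F i r := fun i r hr => radialFlux_pos (h.continuous_source hγ i)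
    (fun _ => posPow_nonneg) (h.source_zero_pos hκ ha i) hr
  have hF1 : ∀ i r, 0 < r → F i r ≤ r := fun i r hr => radialFlux_le (h.continuous_source hγ i)
    (fun _ => posPow_le_one (hγ i) (hw1 _ _)) hr.le
  have hw' : ∀ i r, 0 < r → HasDerivAt (w i) (-(F i r) ^ κ i) r := by
    intro i r hr
    rw [funext (h.2 i)]
    have := (hasDerivAt_radialPotential (N := N) (hκ i) (h.continuous_source hγ i) r).const_sub (a i)
    rwa [max_eq_left (hF0 i r hr).le] at this
  have hF' : ∀ i r, 0 < r →
      HasDerivAt (F i) (w (!i) r ^ γ i - ((N:ℝ) - 1) * F i r / r) r := by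
    intro i r hr
    rw [← hg]
    exact hasDerivAt_radialFlux hN1 (h.continuous_source hγ i) hr
  have hX : ∀ i r, 0 < r → r * w (!i) r ^ γ i ≤ N * F i r := by
    intro i r hr
    rw [← hg]
    refine mul_le_radialFlux hN1 (h.continuous_source hγ i) hr fun t ht => ?_
    simp only [hg]
    exact Real.rpow_le_rpow (hpos _ _).le (h.antitone hκ hγ (!i) ht.2) (hγ i).le
  exact radial_liouville (u := w true) (v := w false) (by exact_mod_cast hN) (hγ true) (hγ false)
    (hκ true) (hκ false) (hκ1 true) (hκ1 false) hD hsub (fun r _ => hpos true r)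
    (fun r _ => hpos false r) (fun r _ => hw1 true r) (fun r _ => hw1 false r) (hF0 true)
    (hF0 false) (hF1 true) (hF1 false) (hw' true) (hw' false) (hF' true) (hF' false)
    (hX true) (hX false)

lemma IsRadialShot.scale (h : IsRadialShot N κ γ a w) {α : Bool → ℝ}
    (hα : ∀ i, α i = κ i * (γ i * α (!i) - 1) - 1) {l : ℝ} (hl : 0 < l) :
    IsRadialShot N κ γ (fun i => l ^ α i * a i) (fun i r => l ^ α i * w i (l * r)) := by
  refine ⟨fun i => continuous_const.mul ((h.1 i).comp (by fun_prop)), fun i r => ?_⟩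
  have e : (fun t => posPow (γ i) (l ^ α (!i) * w (!i) (l * t)))
      = fun t => l ^ (γ i * α (!i)) * (fun s => posPow (γ i) (w (!i) s)) (l * t) := by
    funext t
    rw [posPow_mul (by positivity), ← Real.rpow_mul hl.le, mul_comm (α _)]
  have e' := radialPotential_scale (N := N) (m := κ i) (g := fun s => posPow (γ i) (w (!i) s))
    (c := l ^ (γ i * α (!i))) (by positivity) hl r
  change l ^ α i * w i (l * r) = l ^ α i * a i
    - radialPotential N (κ i) (fun t => posPow (γ i) (l ^ α (!i) * w (!i) (l * t))) r
  rw [e, e', h.2 i (l * r), mul_sub]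
  congr 2
  rw [← Real.rpow_sub_one hl.ne', ← Real.rpow_mul hl.le, ← Real.rpow_sub_one hl.ne', hα i]
  ring_nf

lemma IsRadialShot.isRadialSolution {p q δ μ R : ℝ}
    (h : IsRadialShot N (fun i => if i then 1 / (p - 1) else 1 / (q - 1))
      (fun i => if i then δ else μ) a w) (hN : 1 ≤ N) (hp : 2 ≤ p) (hq : 2 ≤ q) (hδ : 0 < δ)
    (hμ : 0 < μ) (hκ : ∀ i : Bool, 0 < if i then 1 / (p - 1) else 1 / (q - 1)) (ha : ∀ i, 0 < a i)
    (hz : ∀ i, w i R = 0 ∧ ∀ r < R, 0 < w i r) :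
    IsRadialSolution N p q δ μ R (w true) (w false) := by
  have hγ : ∀ i : Bool, 0 < if i then δ else μ := by rintro (_ | _) <;> assumption
  obtain ⟨u1, u2, u3, u4⟩ := radialPotential_regular hN hp (h.continuous_source hγ true)
    (fun _ => posPow_nonneg) (h.source_zero_pos hκ ha true) (h.2 true)
  obtain ⟨v1, v2, v3, v4⟩ := radialPotential_regular hN hq (h.continuous_source hγ false)
    (fun _ => posPow_nonneg) (h.source_zero_pos hκ ha false) (h.2 false)
  have hnn : ∀ i, ∀ r ≤ R, max (w i r) 0 = w i r := by
    intro i r hr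
    refine max_eq_left ?_
    rcases hr.lt_or_eq with hr | rfl
    · exact ((hz i).2 r hr).le
    · exact (hz i).1.ge
  refine ⟨u1.contDiffOn, v1.contDiffOn, u2.mono Ioc_subset_Ioi_self, v2.mono Ioc_subset_Ioi_self,
    fun r hr => (hz _).2 r hr.2, fun r hr => (hz _).2 r hr.2, u3, v3, (hz _).1, (hz _).1,
    fun r hr => ?_, fun r hr => ?_⟩
  · rw [u4 r hr.1, posPow, hnn _ r hr.2]
    rfl
  · rw [v4 r hr.1, posPow, hnn _ r hr.2]
    rfl

end

/-- Theorem 1.4(2): existence of a regular radial solution to (S_R) in the superquadratic case. -/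
theorem existence_superquadratic (N : ℕ) (hN : 2 ≤ N) (p q δ μ : ℝ)
    (hδ : 0 < δ) (hμ : 0 < μ) (hH1 : 0 < δ * μ - (p - 1) * (q - 1))
    (hp1 : 2 ≤ p) (hp2 : p < (N : ℝ)) (hq1 : 2 ≤ q) (hq2 : q < (N : ℝ))
    (hineq : 1 / (δ + 1) + 1 / (μ + 1) >
      ((N : ℝ) * (max p q - 1) - max p q) / (N * (max p q - 1))) :
    ∀ R : ℝ, 0 < R → ∃ u v : ℝ → ℝ, IsRadialSolution N p q δ μ R u v := by
  intro R hR
  have hp : 0 < p - 1 := by linarith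
  have hq : 0 < q - 1 := by linarith
  set κ : Bool → ℝ := fun i => if i then 1 / (p - 1) else 1 / (q - 1) with hκdef
  set γ : Bool → ℝ := fun i => if i then δ else μ with hγdef
  have hκ : ∀ i, 0 < κ i := by rintro (_ | _) <;> simp [hκdef, hp, hq]
  have hκ1 : ∀ i, κ i ≤ 1 := by
    rintro (_ | _)
    · exact (div_le_one hq).2 (by linarith)
    · exact (div_le_one hp).2 (by linarith)
  have hγ : ∀ i, 0 < γ i := by rintro (_ | _) <;> simp [hγdef, hδ, hμ]
  have hD : 1 < κ true * κ false * γ true * γ false := by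
    have : κ true * κ false * γ true * γ false = δ * μ / ((p - 1) * (q - 1)) := by
      simp only [hκdef, hγdef, if_true, Bool.false_eq_true, if_false]; field_simp
    rw [this, one_lt_div (by positivity)]
    linarith
  have hsub : 0 < (N:ℝ) * (1 / (1 + γ true) + 1 / (1 + γ false))
      - ((N:ℝ) - 1 - min (κ true) (κ false)) := by
    have hmin : min (κ true) (κ false) = 1 / (max p q - 1) := by
      simp only [hκdef, if_true, Bool.false_eq_true, if_false]
      rcases le_total p q with hpq | hpq
      · rw [max_eq_right hpq, min_eq_right (one_div_le_one_div_of_le hp (by linarith))]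
      · rw [max_eq_left hpq, min_eq_left (one_div_le_one_div_of_le hq (by linarith))]
    have hM : 0 < max p q - 1 := by have := le_max_left p q; linarith
    have hN0 : (0:ℝ) < N := by positivity
    have e : (N:ℝ) * (((N:ℝ) * (max p q - 1) - max p q) / (N * (max p q - 1)))
        = (N:ℝ) - 1 - 1 / (max p q - 1) := by
      field_simp; ring
    have := mul_lt_mul_of_pos_left hineq hN0
    rw [e] at this
    rw [hmin]
    simp only [hγdef, if_true, Bool.false_eq_true, if_false, add_comm (1:ℝ)]
    linarith
  obtain ⟨s, hs, w, hwc, hw, hbal⟩ := exists_balanced_shot (N := N) hκ hκ1 hγ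
  have hshot : IsRadialShot N κ γ (shotData s) w := ⟨hwc, hw⟩
  have ha := hshot.shotData_pos hκ hγ hs hbal
  obtain ⟨R₀, hR₀, hz⟩ := hshot.exists_common_zero hκ hγ ha hbal
    (hshot.exists_nonpos hN hκ hκ1 hγ ha (fun i => (shotData_mem hs i).2) hD hsub)
  set D := κ true * κ false * γ true * γ false - 1 with hDdef
  set α : Bool → ℝ := fun i => (κ i * γ i * (κ (!i) + 1) + κ i + 1) / D with hαdef
  have hα : ∀ i, α i = κ i * (γ i * α (!i) - 1) - 1 := by
    have hD0 : D ≠ 0 := by linarith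
    rintro (_ | _) <;> simp only [hαdef, Bool.not_true, Bool.not_false] <;> field_simp <;>
      rw [hDdef] <;> ring
  have hl : 0 < R₀ / R := div_pos hR₀ hR
  refine ⟨_, _, (hshot.scale hα hl).isRadialSolution (R := R) (by omega) hp1 hq1 hδ hμ hκ
    (fun i => mul_pos (Real.rpow_pos_of_pos hl _) (ha i)) fun i => ⟨?_, fun r hr => ?_⟩⟩
  · simp only [div_mul_cancel₀ _ hR.ne', (hz i).1, mul_zero]
  · refine mul_pos (Real.rpow_pos_of_pos hl _) ((hz i).2 _ ?_)
    rw [div_mul_eq_mul_div, div_lt_iff₀ hR]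
    exact mul_lt_mul_of_pos_left hr hR₀
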